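/- arXiv:2201.03635 — 2 statements merged into one kernel-verified Lean document; each statement's English description precedes it below -/
import Mathlib

section
/- Let u : ℝ × ℝ → ℝ be a smooth solution of equation (∗) and let f : ℝ → ℝ be continuously differentiable. Then the conservation law ∂_t[f(t)e^{x}(u − u_{xx})] + ∂_x[e^{x}(f(t)(2u_x² − 4u u_x + 2u u_{xx}) − f'(t)(u − u_x))] = 0 holds identically on ℝ × ℝ. -/
open Real MeasureTheory Set Filter

/-- Partial derivative of `u` with respect to the first (time) variable. -/
noncomputable def ut (u : ℝ × ℝ → ℝ) (t x : ℝ) : ℝ := deriv (fun s => u (s, x)) t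
/-- Partial derivative of `u` with respect to the second (spatial) variable. -/
noncomputable def ux (u : ℝ × ℝ → ℝ) (t x : ℝ) : ℝ := deriv (fun y => u (t, y)) x
noncomputable def uxx (u : ℝ × ℝ → ℝ) (t x : ℝ) : ℝ := deriv (fun y => ux u t y) x
noncomputable def uxxx (u : ℝ × ℝ → ℝ) (t x : ℝ) : ℝ := deriv (fun y => uxx u t y) x
noncomputable def utx (u : ℝ × ℝ → ℝ) (t x : ℝ) : ℝ := deriv (fun y => ut u t y) x
noncomputable def utxx (u : ℝ × ℝ → ℝ) (t x : ℝ) : ℝ := deriv (fun y => utx u t y) x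

/-- `u` satisfies the Novikov-type equation (∗) at the point `(t, x)`. -/
def SolvesAt (u : ℝ × ℝ → ℝ) (t x : ℝ) : Prop :=
  ut u t x - utxx u t x =
    4 * u (t, x) * ux u t x + 2 * (ux u t x) ^ 2 + 2 * u (t, x) * uxx u t x
      - 6 * ux u t x * uxx u t x - 2 * u (t, x) * uxxx u t x

/-- `u` is a solution of the Novikov-type equation (∗) on all of `ℝ × ℝ`. -/
def IsSolution (u : ℝ × ℝ → ℝ) : Prop := ∀ t x : ℝ, SolvesAt u t x

lemma ux_eq_fderiv {u : ℝ × ℝ → ℝ} (hu : Differentiable ℝ u) (t x : ℝ) :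
    ux u t x = fderiv ℝ u (t, x) (0, 1) :=
  ((hu (t, x)).hasFDerivAt.comp_hasDerivAt x
    ((hasDerivAt_const x t).prodMk (hasDerivAt_id x))).deriv

lemma ut_eq_fderiv {u : ℝ × ℝ → ℝ} (hu : Differentiable ℝ u) (t x : ℝ) :
    ut u t x = fderiv ℝ u (t, x) (1, 0) :=
  ((hu (t, x)).hasFDerivAt.comp_hasDerivAt t
    ((hasDerivAt_id t).prodMk (hasDerivAt_const t x))).deriv

lemma contDiff_ux {u : ℝ × ℝ → ℝ} (hu : ContDiff ℝ (⊤ : ℕ∞) u) :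
    ContDiff ℝ (⊤ : ℕ∞) fun p : ℝ × ℝ => ux u p.1 p.2 := by
  simp_rw [ux_eq_fderiv (hu.differentiable (by simp))]
  exact (hu.fderiv_right (by simp)).clm_apply contDiff_const

/-- Symmetry of the mixed second partial derivatives. -/
lemma deriv_ux_eq_utx {u : ℝ × ℝ → ℝ} (hu : ContDiff ℝ (⊤ : ℕ∞) u) (t x : ℝ) :
    deriv (fun s => ux u s x) t = utx u t x := by
  have hd : Differentiable ℝ u := hu.differentiable (by simp)
  have hd' : Differentiable ℝ (fderiv ℝ u) :=
    (hu.fderiv_right (m := (⊤ : ℕ∞)) (by simp)).differentiable (by simp)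
  have hfd (v : ℝ × ℝ) (w : ℝ × ℝ) :
      fderiv ℝ (fun p => fderiv ℝ u p v) (t, x) w = fderiv ℝ (fderiv ℝ u) (t, x) w v := by
    rw [fderiv_clm_apply (hd' _) (differentiableAt_const v)]
    simp
  have hsymm : IsSymmSndFDerivAt ℝ u (t, x) :=
    hu.contDiffAt.isSymmSndFDerivAt (by
      simpa using WithTop.coe_le_coe.2 (le_top : (2 : ℕ∞) ≤ ⊤))
  have ht := ut_eq_fderiv (u := fun p => fderiv ℝ u p (0, 1))
    (hd'.clm_apply (differentiable_const _)) t x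
  have hx := ux_eq_fderiv (u := fun p => fderiv ℝ u p (1, 0))
    (hd'.clm_apply (differentiable_const _)) t x
  simp only [utx, ux_eq_fderiv hd, ut_eq_fderiv hd]
  exact ht.trans ((hfd _ _).trans ((hsymm.eq _ _).trans ((hfd _ _).symm.trans hx.symm)))

lemma deriv_uxx_eq_utxx {u : ℝ × ℝ → ℝ} (hu : ContDiff ℝ (⊤ : ℕ∞) u) (t x : ℝ) :
    deriv (fun s => uxx u s x) t = utxx u t x := by
  refine (deriv_ux_eq_utx (contDiff_ux hu) t x).trans ?_
  exact congrArg (fun g => deriv g x) (funext fun y => deriv_ux_eq_utx hu t y)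

lemma hasDerivAt_space {u : ℝ × ℝ → ℝ} (hu : ContDiff ℝ (⊤ : ℕ∞) u) (t x : ℝ) :
    HasDerivAt (fun y => u (t, y)) (ux u t x) x :=
  ((hu.differentiable (by simp)).comp
    ((differentiable_const t).prodMk differentiable_id) x).hasDerivAt

lemma hasDerivAt_time {u : ℝ × ℝ → ℝ} (hu : ContDiff ℝ (⊤ : ℕ∞) u) (t x : ℝ) :
    HasDerivAt (fun s => u (s, x)) (ut u t x) t :=
  ((hu.differentiable (by simp)).comp
    (differentiable_id.prodMk (differentiable_const x)) t).hasDerivAt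

/-- The conserved current (3.0.3): for any `C¹` function `f`, on smooth solutions of (∗),
`∂_t [f(t) e^x (u − u_xx)] + ∂_x [e^x (f(t)(2u_x² − 4u u_x + 2u u_xx) − f'(t)(u − u_x))] = 0`. -/
theorem conservation_law_three (u : ℝ × ℝ → ℝ) (hu : ContDiff ℝ (⊤ : ℕ∞) u)
    (hsol : IsSolution u) (f : ℝ → ℝ) (hf : ContDiff ℝ 1 f) :
    ∀ t x : ℝ,
      deriv (fun s => f s * Real.exp x * (u (s, x) - uxx u s x)) t +
        deriv (fun y => Real.exp y * (f t * (2 * (ux u t y) ^ 2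
          - 4 * u (t, y) * ux u t y + 2 * u (t, y) * uxx u t y)
          - deriv f t * (u (t, y) - ux u t y))) x = 0 := by
  intro t x
  have hux := contDiff_ux hu
  have huxx : ContDiff ℝ (⊤ : ℕ∞) fun p : ℝ × ℝ => uxx u p.1 p.2 := contDiff_ux hux
  have dt : HasDerivAt (fun s => u (s, x)) (ut u t x) t := hasDerivAt_time hu t x
  have dxxt : HasDerivAt (fun s => uxx u s x) (utxx u t x) t :=
    deriv_uxx_eq_utxx hu t x ▸ hasDerivAt_time huxx t x
  have dx : HasDerivAt (fun y => u (t, y)) (ux u t x) x := hasDerivAt_space hu t x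
  have dxx : HasDerivAt (fun y => ux u t y) (uxx u t x) x := hasDerivAt_space hux t x
  have dxxx : HasDerivAt (fun y => uxx u t y) (uxxx u t x) x := hasDerivAt_space huxx t x
  have df : HasDerivAt f (deriv f t) t := (hf.differentiable (by simp) t).hasDerivAt
  have hT := (df.mul_const (Real.exp x)).fun_mul (dt.fun_sub dxxt)
  have hX := (Real.hasDerivAt_exp x).fun_mul
    ((((((dxx.fun_pow 2).const_mul 2).fun_sub ((dx.const_mul 4).fun_mul dxx)).fun_add
      ((dx.const_mul 2).fun_mul dxxx)).const_mul (f t)).fun_sub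
        ((dx.fun_sub dxx).const_mul (deriv f t)))
  rw [hT.deriv, hX.deriv]
  have h := hsol t x
  unfold SolvesAt at h
  push_cast
  linear_combination (f t * Real.exp x) * h
end

section
/- Let u : ℝ × ℝ → ℝ be a smooth solution of equation (∗) such that, for each fixed t, the functions u, u_x, u_{xx}, u_{xxx}, u_t, u_{tx}, u_{txx} (in the x variable) are bounded on ℝ and tend to 0 as x → ±∞. Then for all (t,x) ∈ ℝ × ℝ, u_t(t,x) + u(t,x)² − 2u(t,x)u_x(t,x) = ∫_ℝ G(x − y) u(t,y)² dy, where G(x) := (1 − sgn(x))·e^{−|x|}/2. -/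
open Real MeasureTheory Set Filter

/-- The kernel `G (x) = (1 − sgn x) e^{−|x|} / 2` (with `sgn 0 = 0`). -/
noncomputable def G (x : ℝ) : ℝ := (1 - Real.sign x) * Real.exp (-|x|) / 2

theorem contDiff_ut {u : ℝ × ℝ → ℝ} (hu : ContDiff ℝ (⊤ : ℕ∞) u) (t : ℝ) :
    ContDiff ℝ (⊤ : ℕ∞) (fun x => ut u t x) := by
  have h : (fun x => ut u t x) = fun x => fderiv ℝ u (t, x) (1, 0) := by
    funext x
    have h1 : HasDerivAt (fun s : ℝ => (s, x)) ((1 : ℝ), (0 : ℝ)) t :=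
      (hasDerivAt_id t).prodMk (hasDerivAt_const t x)
    have h2 : HasFDerivAt u (fderiv ℝ u (t, x)) (t, x) :=
      ((hu.differentiable (by simp)) (t, x)).hasFDerivAt
    exact (h2.comp_hasDerivAt t h1).deriv
  rw [h]
  have h1 : ContDiff ℝ (⊤ : ℕ∞) (fderiv ℝ u) := hu.fderiv_right (by simp)
  exact (h1.comp (contDiff_const.prodMk contDiff_id)).clm_apply contDiff_const

theorem contDiff_top_deriv {f : ℝ → ℝ} (hf : ContDiff ℝ (⊤ : ℕ∞) f) :
    ContDiff ℝ (⊤ : ℕ∞) (deriv f) :=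
  (contDiff_infty_iff_deriv.1 hf).2

theorem hasDerivAt_of_contDiff_top {f : ℝ → ℝ} (hf : ContDiff ℝ (⊤ : ℕ∞) f) (x : ℝ) :
    HasDerivAt f (deriv f x) x :=
  (hf.differentiable (by simp) x).hasDerivAt

/-- A solution of `B' = -B` on the line that tends to `0` at `-∞` vanishes. -/
theorem eq_zero_of_hasDerivAt_neg_self {B : ℝ → ℝ} (hB : ∀ x, HasDerivAt B (-B x) x)
    (h0 : Tendsto B atBot (nhds 0)) (x : ℝ) : B x = 0 := by
  have hd : ∀ y, HasDerivAt (fun y => Real.exp y * B y) 0 y := fun y => by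
    have h := (Real.hasDerivAt_exp y).mul (hB y)
    rwa [show Real.exp y * B y + Real.exp y * -B y = 0 by ring] at h
  have hconst : ∀ y, Real.exp y * B y = Real.exp x * B x := fun y =>
    is_const_of_deriv_eq_zero (fun z => (hd z).differentiableAt) (fun z => (hd z).deriv) y x
  have hlim : Tendsto (fun y => Real.exp y * B y) atBot (nhds (0 * 0)) :=
    Real.tendsto_exp_atBot.mul h0
  simp only [hconst, mul_zero] at hlim
  have h := tendsto_nhds_unique hlim tendsto_const_nhds
  exact (mul_eq_zero.1 h.symm).resolve_left (Real.exp_ne_zero x)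

theorem integral_G_mul (f : ℝ → ℝ) (x : ℝ) :
    ∫ y, G (x - y) * f y = ∫ y in Ioi x, Real.exp (x - y) * f y := by
  rw [← integral_indicator measurableSet_Ioi]
  refine integral_congr_ae ?_
  filter_upwards [Measure.ae_ne volume x] with y hy
  rcases lt_or_gt_of_ne hy with h | h
  · rw [indicator_of_notMem (by simpa using h.le)]
    simp [G, Real.sign_of_pos (sub_pos.2 h)]
  · rw [indicator_of_mem (by simpa using h), G, Real.sign_of_neg (sub_neg.2 h),
      abs_of_neg (sub_neg.2 h)]
    ring_nf

/-- If `A - A' = f` with `f` nonnegative and `A` tending to `0` at `+∞`, then `A = G ∗ f`. -/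
theorem eq_integral_G_mul {A f : ℝ → ℝ} (hA : ∀ x, HasDerivAt A (A x - f x) x)
    (hf : ∀ x, 0 ≤ f x) (h0 : Tendsto A atTop (nhds 0)) (x : ℝ) :
    A x = ∫ y, G (x - y) * f y := by
  have hd : ∀ y, HasDerivAt (fun y => -(Real.exp (x - y) * A y)) (Real.exp (x - y) * f y) y := by
    intro y
    have h := ((((hasDerivAt_id y).const_sub x).exp).mul (hA y)).neg
    refine h.congr_deriv ?_
    simp only [id]
    ring
  have hlim : Tendsto (fun y => -(Real.exp (x - y) * A y)) atTop (nhds 0) := by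
    have he : Tendsto (fun y => Real.exp (x - y)) atTop (nhds 0) :=
      Real.tendsto_exp_atBot.comp (tendsto_const_nhds.add_atBot tendsto_neg_atTop_atBot)
    simpa using (he.mul h0).neg
  rw [integral_G_mul, integral_Ioi_of_hasDerivAt_of_nonneg' (fun y _ => hd y)
    (fun y _ => mul_nonneg (Real.exp_pos _).le (hf y)) hlim]
  simp

/-- The nonlocal form (4.0.2): for smooth solutions of (∗) that are bounded and decay at
spatial infinity together with `u_x, u_xx, u_xxx, u_t, u_tx, u_txx`, one has
`u_t + u² − 2u u_x = G ∗ u²`. -/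
theorem nonlocal_form (u : ℝ × ℝ → ℝ) (hu : ContDiff ℝ (⊤ : ℕ∞) u) (hsol : IsSolution u)
    (hdecay : ∀ t : ℝ, ∀ F ∈ ({fun x => u (t, x), fun x => ux u t x, fun x => uxx u t x,
        fun x => uxxx u t x, fun x => ut u t x, fun x => utx u t x,
        fun x => utxx u t x} : Set (ℝ → ℝ)),
      (∃ C : ℝ, ∀ x : ℝ, |F x| ≤ C) ∧
        Tendsto F atTop (nhds 0) ∧ Tendsto F atBot (nhds 0)) :
    ∀ t x : ℝ,
      ut u t x + (u (t, x)) ^ 2 - 2 * u (t, x) * ux u t x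
        = ∫ y : ℝ, G (x - y) * (u (t, y)) ^ 2 := by
  intro t
  have hv : ContDiff ℝ (⊤ : ℕ∞) (fun x => u (t, x)) :=
    hu.comp (contDiff_const.prodMk contDiff_id)
  have hvx : ContDiff ℝ (⊤ : ℕ∞) (fun x => ux u t x) := contDiff_top_deriv hv
  have hvxx : ContDiff ℝ (⊤ : ℕ∞) (fun x => uxx u t x) := contDiff_top_deriv hvx
  have hw := contDiff_ut hu t
  have hwx : ContDiff ℝ (⊤ : ℕ∞) (fun x => utx u t x) := contDiff_top_deriv hw
  have dv : ∀ x, HasDerivAt (fun x => u (t, x)) (ux u t x) x := hasDerivAt_of_contDiff_top hv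
  have dvx : ∀ x, HasDerivAt (fun x => ux u t x) (uxx u t x) x := hasDerivAt_of_contDiff_top hvx
  have dvxx : ∀ x, HasDerivAt (fun x => uxx u t x) (uxxx u t x) x :=
    hasDerivAt_of_contDiff_top hvxx
  have dw : ∀ x, HasDerivAt (fun x => ut u t x) (utx u t x) x := hasDerivAt_of_contDiff_top hw
  have dwx : ∀ x, HasDerivAt (fun x => utx u t x) (utxx u t x) x :=
    hasDerivAt_of_contDiff_top hwx
  obtain ⟨-, v_top, v_bot⟩ := hdecay t (fun x => u (t, x)) (by simp)
  obtain ⟨-, vx_top, vx_bot⟩ := hdecay t (fun x => ux u t x) (by simp)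
  obtain ⟨-, -, vxx_bot⟩ := hdecay t (fun x => uxx u t x) (by simp)
  obtain ⟨-, w_top, w_bot⟩ := hdecay t (fun x => ut u t x) (by simp)
  obtain ⟨-, -, wx_bot⟩ := hdecay t (fun x => utx u t x) (by simp)
  have dA : ∀ x, HasDerivAt (fun x => ut u t x + u (t, x) ^ 2 - 2 * u (t, x) * ux u t x)
      (utx u t x + 2 * u (t, x) * ux u t x - 2 * ux u t x ^ 2 - 2 * u (t, x) * uxx u t x) x := by
    intro x
    refine (((dw x).add ((dv x).pow 2)).sub (((dv x).const_mul 2).mul (dvx x))).congr_deriv ?_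
    ring
  -- `B = A - A' - u²`, where `A` is the left-hand side of the claim.
  let B : ℝ → ℝ := fun x => ut u t x - 4 * (u (t, x) * ux u t x) - utx u t x
    + 2 * ux u t x ^ 2 + 2 * (u (t, x) * uxx u t x)
  have dB : ∀ x, HasDerivAt B (-B x) x := by
    intro x
    refine (((((dw x).sub (((dv x).mul (dvx x)).const_mul 4)).sub (dwx x)).add
      (((dvx x).pow 2).const_mul 2)).add (((dv x).mul (dvxx x)).const_mul 2)).congr_deriv ?_
    have h := hsol t x
    unfold SolvesAt at h
    simp only [B]
    linear_combination h
  have B_bot : Tendsto B atBot (nhds 0) := by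
    simpa using (((w_bot.sub ((v_bot.mul vx_bot).const_mul 4)).sub wx_bot).add
      ((vx_bot.pow 2).const_mul 2)).add ((v_bot.mul vxx_bot).const_mul 2)
  refine eq_integral_G_mul (fun x => (dA x).congr_deriv ?_) (fun x => sq_nonneg _) ?_
  · have h := eq_zero_of_hasDerivAt_neg_self dB B_bot x
    simp only [B] at h
    linear_combination -h
  · simpa using (w_top.add (v_top.pow 2)).sub ((v_top.const_mul 2).mul vx_top)
end
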